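/- Let G = (V, E) be a finite directed acyclic graph (PERT network) with source s and sink t, |E| = n, K a positive integer, r an integer with 0 ≤ r ≤ nK, and for each edge (i,j) ∈ E let p_{ij,0},…,p_{ij,K} be nonnegative reals summing to 1. Let U^pert(r) be the maximum of P_θ(Z^pert(c̃) ≥ r) over all joint distributions θ on {0,…,K}^E with P_θ(c̃_{ij} = k) = p_{ij,k}. Then U^pert(r) equals the optimal value of the linear program: maximize a over nonnegative variables a, b, h_{ijk}, g_{ijk}, δ_{ij,k,l}, τ_l subject to: a + b = 1; Σ_{k=0}^K h_{ijk} = b for all (i,j) ∈ E; Σ_{k=0}^K g_{ijk} + Σ_{k=0}^K Σ_{l=k}^{nK} δ_{ij,k,l} = a for all (i,j) ∈ E; h_{ijk} + g_{ijk} + Σ_{l=k}^{nK} δ_{ij,k,l} = p_{ij,k} for all (i,j) ∈ E and k ∈ {0,…,K}; a = Σ_{l=r}^{nK} τ_l; τ_l = Σ_{i:(i,t)∈E} Σ_{k=0}^{min(l,K)} δ_{it,k,l} for l ∈ {r,…,nK}; Σ_{j:(i,j)∈E} Σ_{k=0}^{min(K,nK−l)} δ_{ij,k,l+k} = Σ_{j:(j,i)∈E}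 Σ_{k=0}^{min(K,l)} δ_{ji,k,l} for every vertex i ∉ {s,t} and l ∈ {0,…,nK}; Σ_{i:(i,t)∈E} Σ_{k=0}^{min(l,K)} δ_{it,k,l} = 0 for l ∈ {0,…,r−1}; and Σ_{i:(s,i)∈E} Σ_{k=0}^{min(K,nK−l)} δ_{si,k,l+k} = 0 for l ∈ {1,…,nK}. -/

import Mathlib

open Finset
open scoped Classical

/-- `P` is a directed path from `s` to `t` in the directed graph with edge set `E`,
represented as the list of its edges. -/
def IsDipath {V : Type*} (E : Finset (V × V)) (s t : V) (P : List (V × V)) : Prop :=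
  (∀ e ∈ P, e ∈ E) ∧ List.Chain' (fun e f => e.2 = f.1) P ∧
    ((P = [] ∧ s = t) ∨
      ((P.map Prod.fst).head? = some s ∧ (P.map Prod.snd).getLast? = some t ∧
        (P.map Prod.fst).Nodup ∧ t ∉ P.map Prod.fst))

section FlowDecomposition

variable {α N : Type*}

/-- `X` is a walk of arcs of `A` starting at `v` that stops the first time it meets `T`. -/
def IsArcPath (A : Finset α) (src dst : α → N) (T : N → Prop) : N → List α → Prop
  | v, [] => T v
  | v, x :: X => x ∈ A ∧ src x = v ∧ ¬ T v ∧ IsArcPath A src dst T (dst x) X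

variable {A : Finset α} {src dst : α → N} {T : N → Prop} {rank : N → ℕ}

theorem IsArcPath.mem {v : N} {X : List α} (hX : IsArcPath A src dst T v X) :
    ∀ x ∈ X, x ∈ A := by
  induction X generalizing v with
  | nil => simp
  | cons y X ih =>
    obtain ⟨hy, -, -, hX⟩ := hX
    simpa [hy] using ih hX

theorem IsArcPath.rank_le (hrank : ∀ x ∈ A, rank (src x) < rank (dst x)) {v : N} {X : List α}
    (hX : IsArcPath A src dst T v X) : ∀ x ∈ X, rank v ≤ rank (src x) := by
  induction X generalizing v with
  | nil => simp
  | cons y X ih =>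
    obtain ⟨hy, rfl, -, hX⟩ := hX
    intro x hx
    rcases List.mem_cons.1 hx with rfl | hx
    · exact le_rfl
    · exact (hrank y hy).le.trans (ih hX x hx)

theorem IsArcPath.nodup_map_src (hrank : ∀ x ∈ A, rank (src x) < rank (dst x)) {v : N}
    {X : List α} (hX : IsArcPath A src dst T v X) : (X.map src).Nodup := by
  induction X generalizing v with
  | nil => simp
  | cons y X ih =>
    obtain ⟨hy, rfl, -, hX⟩ := hX
    rw [List.map_cons, List.nodup_cons]
    refine ⟨fun hmem => ?_, ih hX⟩
    obtain ⟨x, hx, hxy⟩ := List.mem_map.1 hmem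
    have h1 := hX.rank_le hrank x hx
    have h2 := hrank y hy
    rw [hxy] at h1
    omega

theorem IsArcPath.not_stop {v : N} {X : List α}
    (hX : IsArcPath A src dst T v X) : ∀ x ∈ X, ¬ T (src x) := by
  induction X generalizing v with
  | nil => simp
  | cons y X ih =>
    obtain ⟨-, rfl, hT, hX⟩ := hX
    simpa [hT] using ih hX

theorem IsArcPath.countP_stop {v : N} {X : List α}
    (hX : IsArcPath A src dst T v X) :
    X.countP (fun x => T (dst x)) = if T v then 0 else 1 := by
  induction X generalizing v with
  | nil =>
    have : T v := hX
    simp [this]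
  | cons y X ih =>
    obtain ⟨-, rfl, hT, hX⟩ := hX
    rw [List.countP_cons, ih hX]
    by_cases h : T (dst y) <;> simp [h, hT]

theorem IsArcPath.countP_src [DecidableEq N] {v : N} {X : List α}
    (hX : IsArcPath A src dst T v X) {u : N} (hu : ¬ T u) :
    X.countP (fun x => src x = u) = X.countP (fun x => dst x = u) + if u = v then 1 else 0 := by
  induction X generalizing v with
  | nil =>
    have hv : T v := hX
    have : u ≠ v := by rintro rfl; exact hu hv
    simp [this]
  | cons y X ih =>
    obtain ⟨-, rfl, -, hX⟩ := hX
    rw [List.countP_cons, List.countP_cons, ih hX]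
    simp only [decide_eq_true_eq, eq_comm (a := u)]

theorem sum_filter_count [BEq α] [LawfulBEq α] {p : α → Prop} [DecidablePred p] {X : List α}
    (hX : ∀ x ∈ X, x ∈ A) :
    ∑ x ∈ A.filter p, (X.count x : ℝ) = X.countP p := by
  induction X with
  | nil => simp
  | cons y X ih =>
    have hy : y ∈ A := hX y (by simp)
    have ih := ih fun x hx => hX x (by simp [hx])
    simp only [List.count_cons, List.countP_cons, Nat.cast_add, sum_add_distrib, ih]
    congr 1
    by_cases h : p y <;> simp [h, hy, Finset.sum_ite_eq]

variable [DecidableEq N] {S : N → Prop} {f : α → ℝ}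

theorem exists_pos_next (hf : ∀ x ∈ A, 0 ≤ f x)
    (hcons : ∀ v, ¬ S v → ¬ T v →
      ∑ x ∈ A.filter (fun x => src x = v), f x = ∑ x ∈ A.filter (fun x => dst x = v), f x)
    {x : α} (hx : x ∈ A) (hfx : 0 < f x) (hS : ¬ S (dst x)) (hT : ¬ T (dst x)) :
    ∃ y ∈ A, 0 < f y ∧ src y = dst x := by
  have h : 0 < ∑ y ∈ A.filter (fun y => src y = dst x), f y := by
    rw [hcons _ hS hT]
    exact Finset.sum_pos' (fun y hy => hf y (mem_filter.1 hy).1) ⟨x, by simp [hx], hfx⟩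
  obtain ⟨y, hy, hfy⟩ := Finset.exists_lt_of_sum_lt (f := fun _ => (0 : ℝ)) (by simpa using h)
  exact ⟨y, (mem_filter.1 hy).1, hfy, (mem_filter.1 hy).2⟩

theorem exists_pos_prev (hf : ∀ x ∈ A, 0 ≤ f x)
    (hcons : ∀ v, ¬ S v → ¬ T v →
      ∑ x ∈ A.filter (fun x => src x = v), f x = ∑ x ∈ A.filter (fun x => dst x = v), f x)
    {x : α} (hx : x ∈ A) (hfx : 0 < f x) (hS : ¬ S (src x)) (hT : ¬ T (src x)) :
    ∃ y ∈ A, 0 < f y ∧ dst y = src x :=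
  exists_pos_next (S := S) (T := T) hf (fun v h1 h2 => (hcons v h1 h2).symm) hx hfx hS hT

/-- No flow leaves the sinks when all sources rank below all sinks. -/
theorem eq_zero_of_src_stop (hrank : ∀ x ∈ A, rank (src x) < rank (dst x))
    (hf : ∀ x ∈ A, 0 ≤ f x)
    (hcons : ∀ v, ¬ S v → ¬ T v →
      ∑ x ∈ A.filter (fun x => src x = v), f x = ∑ x ∈ A.filter (fun x => dst x = v), f x)
    {ρ : ℕ} (hS : ∀ v, S v → rank v ≤ ρ) (hT : ∀ v, T v → rank v = ρ)
    {x : α} (hx : x ∈ A) (hsrc : T (src x)) : f x = 0 := by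
  have key : ∀ d : ℕ, ∀ y ∈ A, 0 < f y → A.sup (fun z => rank (dst z)) ≤ rank (dst y) + d →
      rank (dst y) ≤ ρ := by
    intro d
    induction d with
    | zero =>
      intro y hy hfy hd
      by_cases h1 : S (dst y)
      · exact hS _ h1
      by_cases h2 : T (dst y)
      · exact (hT _ h2).le
      obtain ⟨z, hz, -, hzy⟩ := exists_pos_next hf hcons hy hfy h1 h2
      have := hrank z hz
      have := Finset.le_sup (f := fun z => rank (dst z)) hz
      rw [hzy] at *
      omega
    | succ d ih =>
      intro y hy hfy hd
      by_cases h1 : S (dst y)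
      · exact hS _ h1
      by_cases h2 : T (dst y)
      · exact (hT _ h2).le
      obtain ⟨z, hz, hfz, hzy⟩ := exists_pos_next hf hcons hy hfy h1 h2
      have h3 := hrank z hz
      rw [hzy] at h3
      exact h3.le.trans (ih z hz hfz (by omega))
  by_contra hne
  have hpos : 0 < f x := lt_of_le_of_ne (hf x hx) (Ne.symm hne)
  have h1 := key _ x hx hpos (Nat.le_add_left _ _)
  have h2 := hrank x hx
  rw [hT _ hsrc] at h2
  omega

/-- No flow enters the sources when all sources rank below all sinks. -/
theorem eq_zero_of_dst_start (hrank : ∀ x ∈ A, rank (src x) < rank (dst x))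
    (hf : ∀ x ∈ A, 0 ≤ f x)
    (hcons : ∀ v, ¬ S v → ¬ T v →
      ∑ x ∈ A.filter (fun x => src x = v), f x = ∑ x ∈ A.filter (fun x => dst x = v), f x)
    {ρ : ℕ} (hS : ∀ v, S v → rank v = ρ) (hT : ∀ v, T v → ρ ≤ rank v)
    {x : α} (hx : x ∈ A) (hdst : S (dst x)) : f x = 0 := by
  have key : ∀ d : ℕ, ∀ y ∈ A, 0 < f y → rank (src y) ≤ d → ρ ≤ rank (src y) := by
    intro d
    induction d with
    | zero =>
      intro y hy hfy hd
      by_cases h1 : S (src y)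
      · exact (hS _ h1).ge
      by_cases h2 : T (src y)
      · exact hT _ h2
      obtain ⟨z, hz, -, hzy⟩ := exists_pos_prev hf hcons hy hfy h1 h2
      have := hrank z hz
      rw [hzy] at this
      omega
    | succ d ih =>
      intro y hy hfy hd
      by_cases h1 : S (src y)
      · exact (hS _ h1).ge
      by_cases h2 : T (src y)
      · exact hT _ h2
      obtain ⟨z, hz, hfz, hzy⟩ := exists_pos_prev hf hcons hy hfy h1 h2
      have h3 := hrank z hz
      rw [hzy] at h3
      exact (ih z hz hfz (by omega)).trans h3.le
  by_contra hne
  have hpos : 0 < f x := lt_of_le_of_ne (hf x hx) (Ne.symm hne)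
  have h1 := key _ x hx hpos le_rfl
  have h2 := hrank x hx
  rw [hS _ hdst] at h2
  omega

/-- A nonzero flow carries a path from a source to a sink along arcs of positive flow. -/
theorem exists_pos_arcPath (hrank : ∀ x ∈ A, rank (src x) < rank (dst x))
    (hf : ∀ x ∈ A, 0 ≤ f x)
    (hcons : ∀ v, ¬ S v → ¬ T v →
      ∑ x ∈ A.filter (fun x => src x = v), f x = ∑ x ∈ A.filter (fun x => dst x = v), f x)
    (hS : ∀ x ∈ A, S (dst x) → f x = 0) (hT : ∀ x ∈ A, T (src x) → f x = 0)
    (hne : ∃ x ∈ A, 0 < f x) :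
    ∃ v X, S v ∧ X ≠ [] ∧ IsArcPath A src dst T v X ∧ ∀ x ∈ X, 0 < f x := by
  have key : ∀ d : ℕ, ∀ y ∈ A, 0 < f y → A.sup (fun z => rank (dst z)) < rank (dst y) + d →
      ∃ X, IsArcPath A src dst T (src y) (y :: X) ∧ ∀ x ∈ y :: X, 0 < f x := by
    intro d
    induction d with
    | zero =>
      intro y hy hfy hd
      have := Finset.le_sup (f := fun z => rank (dst z)) hy
      omega
    | succ d ih =>
      intro y hy hfy hd
      have h1 : ¬ T (src y) := fun h => hfy.ne' (hT y hy h)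
      by_cases h2 : T (dst y)
      · exact ⟨[], ⟨hy, rfl, h1, h2⟩, by simpa using hfy⟩
      obtain ⟨z, hz, hfz, hzy⟩ :=
        exists_pos_next hf hcons hy hfy (fun h => hfy.ne' (hS y hy h)) h2
      have h3 := hrank z hz
      rw [hzy] at h3
      obtain ⟨X, hX, hpos⟩ := ih z hz hfz (by omega)
      refine ⟨z :: X, ⟨hy, rfl, h1, hzy ▸ hX⟩, ?_⟩
      intro x hx
      rcases List.mem_cons.1 hx with rfl | hx
      · exact hfy
      · exact hpos x hx
  obtain ⟨x, hx, hmin⟩ := (A.filter fun x => 0 < f x).exists_min_image (fun x => rank (src x))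
    (by obtain ⟨x, hx, hfx⟩ := hne; exact ⟨x, by simp [hx, hfx]⟩)
  obtain ⟨hxA, hfx⟩ := mem_filter.1 hx
  have hSx : S (src x) := by
    by_contra h
    obtain ⟨y, hy, hfy, hyx⟩ :=
      exists_pos_prev hf hcons hxA hfx h (fun h' => hfx.ne' (hT x hxA h'))
    have h1 := hmin y (by simp [hy, hfy])
    have h2 := hrank y hy
    rw [hyx] at h2
    omega
  obtain ⟨X, hX, hpos⟩ := key _ x hxA hfx
    (show _ < _ + (A.sup (fun z => rank (dst z)) + 1) by omega)
  exact ⟨src x, x :: X, hSx, by simp, hX, hpos⟩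

/-- Path decomposition of a flow in a finite acyclic network. -/
theorem exists_path_decomposition [BEq α] [LawfulBEq α]
    (hrank : ∀ x ∈ A, rank (src x) < rank (dst x))
    (hf : ∀ x ∈ A, 0 ≤ f x)
    (hcons : ∀ v, ¬ S v → ¬ T v →
      ∑ x ∈ A.filter (fun x => src x = v), f x = ∑ x ∈ A.filter (fun x => dst x = v), f x)
    (hS : ∀ x ∈ A, S (dst x) → f x = 0) (hT : ∀ x ∈ A, T (src x) → f x = 0) :
    ∃ (m : ℕ) (w : Fin m → ℝ) (X : Fin m → List α), (∀ j, 0 ≤ w j) ∧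
      (∀ j, (∃ v, S v ∧ IsArcPath A src dst T v (X j)) ∧ ∀ x ∈ X j, 0 < f x) ∧
      ∀ x ∈ A, f x = ∑ j, w j * ((X j).count x : ℝ) := by
  induction hm : (A.filter fun x => 0 < f x).card using Nat.strong_induction_on
    generalizing f with
  | _ m ih =>
  subst hm
  by_cases hne : ∃ x ∈ A, 0 < f x
  swap
  · push Not at hne
    refine ⟨0, Fin.elim0, Fin.elim0, fun j => j.elim0, fun j => j.elim0, fun x hx => ?_⟩
    simpa using le_antisymm (hne x hx) (hf x hx)
  obtain ⟨v, X, hv, hX0, hX, hpos⟩ := exists_pos_arcPath hrank hf hcons hS hT hne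
  have hnodup : X.Nodup := List.Nodup.of_map _ (hX.nodup_map_src hrank)
  obtain ⟨z, hz, hmin⟩ := X.toFinset.exists_min_image f
    (by simpa [List.toFinset_nonempty_iff] using hX0)
  rw [List.mem_toFinset] at hz
  have hfz := hpos z hz
  have hcount : ∀ x, (X.count x : ℝ) = if x ∈ X then 1 else 0 := by
    intro x
    rw [hnodup.count]
    split_ifs <;> simp
  set f' : α → ℝ := fun x => f x - f z * X.count x with hf'
  have hle : ∀ x, f' x ≤ f x := by
    intro x
    have : 0 ≤ f z * X.count x := by positivity
    simp only [hf']
    linarith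
  have hf'0 : ∀ x ∈ A, 0 ≤ f' x := by
    intro x hx
    simp only [hf', hcount]
    split_ifs with h
    · have := hmin x (by simpa using h)
      linarith
    · simpa using hf x hx
  have hcons' : ∀ v, ¬ S v → ¬ T v →
      ∑ x ∈ A.filter (fun x => src x = v), f' x
        = ∑ x ∈ A.filter (fun x => dst x = v), f' x := by
    intro u hSu hTu
    simp only [hf', sum_sub_distrib, ← mul_sum, sum_filter_count hX.mem, hcons u hSu hTu,
      hX.countP_src hTu]
    have : u ≠ v := by rintro rfl; exact hSu hv
    simp [this]
  have hlt : (A.filter fun x => 0 < f' x).card < (A.filter fun x => 0 < f x).card := by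
    apply Finset.card_lt_card
    refine Finset.ssubset_iff_of_subset ?_ |>.2 ⟨z, by simp [hfz, hX.mem z hz], ?_⟩
    · intro x hx
      rw [mem_filter] at hx ⊢
      exact ⟨hx.1, hx.2.trans_le (hle x)⟩
    · simp [hf', hcount, hz]
  obtain ⟨m, w, Y, hw, hY, hdec⟩ := ih _ hlt hf'0 hcons'
    (fun x hx h => le_antisymm ((hle x).trans (hS x hx h).le) (hf'0 x hx))
    (fun x hx h => le_antisymm ((hle x).trans (hT x hx h).le) (hf'0 x hx)) rfl
  refine ⟨m + 1, Fin.cons (f z) w, Fin.cons X Y, ?_, ?_, ?_⟩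
  · intro j
    refine Fin.cases ?_ (fun j => ?_) j
    · simpa using hfz.le
    · simpa using hw j
  · intro j
    refine Fin.cases ?_ (fun j => ?_) j
    · exact ⟨⟨v, hv, hX⟩, hpos⟩
    · exact ⟨(hY j).1, fun x hx => ((hY j).2 x hx).trans_le (hle x)⟩
  · intro x hx
    rw [Fin.sum_univ_succ]
    simp only [Fin.cons_zero, Fin.cons_succ, ← hdec x hx, hf']
    ring

end FlowDecomposition

section ProductMixture

variable {ι κ : Type*} [Fintype ι] [DecidableEq ι] [Fintype κ]

theorem sum_prod_eq_one {q : ι → κ → ℝ} (hq : ∀ i, ∑ k, q i k = 1) :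
    ∑ c : ι → κ, ∏ i, q i (c i) = 1 := by
  rw [← Fintype.prod_sum]
  simp [hq]

theorem sum_prod_marginal [DecidableEq κ] {q : ι → κ → ℝ} (hq : ∀ i, ∑ k, q i k = 1) (i₀ : ι) (k₀ : κ) :
    ∑ c ∈ univ.filter (fun c : ι → κ => c i₀ = k₀), ∏ i, q i (c i) = q i₀ k₀ := by
  have h : ∀ c : ι → κ, (if c i₀ = k₀ then ∏ i, q i (c i) else 0)
      = ∏ i, if i = i₀ then (if c i = k₀ then q i (c i) else 0) else q i (c i) := by
    intro c
    split_ifs with hc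
    · refine Finset.prod_congr rfl fun i _ => ?_
      by_cases hi : i = i₀
      · subst hi; simp [hc]
      · simp [hi]
    · exact (Finset.prod_eq_zero (mem_univ i₀) (by simp [hc])).symm
  rw [Finset.sum_filter, Finset.sum_congr rfl fun c _ => h c,
    ← Fintype.prod_sum (fun i k => if i = i₀ then (if k = k₀ then q i k else 0) else q i k),
    Finset.prod_eq_single i₀]
  · simp
  · intro i _ hi
    simp [hi, hq]
  · simp

end ProductMixture

section TimeExpansion

variable {V : Type*} {E : Finset (V × V)} {s t : V}

theorem IsDipath.isArcPath (hst : s ≠ t) {Q : List (V × V)} (hQ : IsDipath E s t Q) :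
    IsArcPath E Prod.fst Prod.snd (· = t) s Q := by
  obtain ⟨hmem, hchain, ⟨-, h⟩ | ⟨hhead, hlast, -, ht⟩⟩ := hQ
  · exact absurd h hst
  induction Q generalizing s with
  | nil => simp at hhead
  | cons e Q ih =>
    have he : e.1 = s := by simpa using hhead
    refine ⟨hmem e (by simp), he, hst, ?_⟩
    cases Q with
    | nil => simpa [IsArcPath] using hlast
    | cons f Q =>
      have hef : e.2 = f.1 := (List.isChain_cons_cons.1 hchain).1
      simp only [List.map_cons, List.mem_cons, not_or] at ht
      exact ih (fun h => ht.2.1 (h.symm.trans hef)) (fun x hx => hmem x (by simp [hx]))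
        (List.isChain_cons_cons.1 hchain).2 (by simp [hef]) (by simpa using hlast)
        (by simpa using ht.2)

theorem IsArcPath.isDipath (hst : s ≠ t) {ord : V → ℕ} (hord : ∀ e ∈ E, ord e.1 < ord e.2)
    {Q : List (V × V)} (hQ : IsArcPath E Prod.fst Prod.snd (· = t) s Q) :
    IsDipath E s t Q := by
  have hnodup : (Q.map Prod.fst).Nodup := hQ.nodup_map_src hord
  have ht : t ∉ Q.map Prod.fst := by
    intro h
    obtain ⟨e, he, h⟩ := List.mem_map.1 h
    exact hQ.not_stop e he h
  have hmem := hQ.mem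
  refine ⟨hmem, ?_⟩
  suffices h : List.IsChain (fun e f => e.2 = f.1) Q ∧
      (Q.map Prod.fst).head? = some s ∧ (Q.map Prod.snd).getLast? = some t from
    ⟨h.1, Or.inr ⟨h.2.1, h.2.2, hnodup, ht⟩⟩
  clear hnodup ht hmem
  induction Q generalizing s with
  | nil => exact absurd hQ hst
  | cons e Q ih =>
    obtain ⟨-, he, -, hQ⟩ := hQ
    cases Q with
    | nil =>
      have h : e.2 = t := hQ
      simp [he, h]
    | cons f Q =>
      have hf : f.1 = e.2 := hQ.2.1
      obtain ⟨h1, -, h3⟩ := ih hQ.2.2.1 hQ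
      refine ⟨List.isChain_cons_cons.2 ⟨hf.symm, h1⟩, by simp [he], ?_⟩
      simpa using h3

variable {K M : ℕ}

/-- Arcs of the time-expanded network: an edge, its duration, and the level it arrives at. -/
def timedArcs (E : Finset (V × V)) (K M : ℕ) : Finset ((V × V) × Fin (K + 1) × ℕ) :=
  (E ×ˢ (univ : Finset (Fin (K + 1))) ×ˢ range (M + 1)).filter fun x => (x.2.1 : ℕ) ≤ x.2.2

/-- The node of the time-expanded network an arc leaves. -/
def timedTail (x : (V × V) × Fin (K + 1) × ℕ) : V × ℕ := (x.1.1, x.2.2 - x.2.1)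

/-- The node of the time-expanded network an arc enters. -/
def timedHead (x : (V × V) × Fin (K + 1) × ℕ) : V × ℕ := (x.1.2, x.2.2)

theorem mem_timedArcs {x : (V × V) × Fin (K + 1) × ℕ} :
    x ∈ timedArcs E K M ↔ x.1 ∈ E ∧ (x.2.1 : ℕ) ≤ x.2.2 ∧ x.2.2 ≤ M := by
  simp [timedArcs]
  tauto

theorem sum_out_eq [DecidableEq V] (F : (V × V) × Fin (K + 1) × ℕ → ℝ) (i : V) {l : ℕ}
    (hl : l ≤ M) :
    ∑ e ∈ E.filter (fun e => e.1 = i),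
      ∑ k ∈ univ.filter (fun k : Fin (K + 1) => (k : ℕ) ≤ M - l), F (e, k, l + (k : ℕ))
    = ∑ x ∈ (timedArcs E K M).filter (fun x => timedTail x = (i, l)), F x := by
  rw [← Finset.sum_product']
  refine Finset.sum_nbij' (fun x => (x.1, x.2, l + (x.2 : ℕ))) (fun x => (x.1, x.2.1))
    ?_ ?_ ?_ ?_ ?_
  · rintro ⟨e, k⟩ h
    simp only [mem_product, mem_filter, mem_univ, true_and] at h
    simp only [mem_filter, mem_timedArcs, timedTail, Prod.mk.injEq]
    exact ⟨⟨h.1.1, by omega, by omega⟩, h.1.2, by omega⟩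
  · rintro ⟨e, k, l'⟩ h
    simp only [mem_filter, mem_timedArcs, timedTail, Prod.mk.injEq] at h
    simp only [mem_product, mem_filter, mem_univ, true_and]
    exact ⟨⟨h.1.1, h.2.1⟩, by omega⟩
  · rintro ⟨e, k⟩ _
    rfl
  · rintro ⟨e, k, l'⟩ h
    simp only [mem_filter, mem_timedArcs, timedTail, Prod.mk.injEq] at h
    simp only [Prod.mk.injEq, true_and]
    omega
  · rintro ⟨e, k⟩ _
    rfl

theorem sum_in_eq [DecidableEq V] (F : (V × V) × Fin (K + 1) × ℕ → ℝ) (i : V) {l : ℕ}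
    (hl : l ≤ M) :
    ∑ e ∈ E.filter (fun e => e.2 = i),
      ∑ k ∈ univ.filter (fun k : Fin (K + 1) => (k : ℕ) ≤ l), F (e, k, l)
    = ∑ x ∈ (timedArcs E K M).filter (fun x => timedHead x = (i, l)), F x := by
  rw [← Finset.sum_product']
  refine Finset.sum_nbij' (fun x => (x.1, x.2, l)) (fun x => (x.1, x.2.1)) ?_ ?_ ?_ ?_ ?_
  · rintro ⟨e, k⟩ h
    simp only [mem_product, mem_filter, mem_univ, true_and] at h
    simp only [mem_filter, mem_timedArcs, timedHead, Prod.mk.injEq]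
    exact ⟨⟨h.1.1, h.2, hl⟩, h.1.2, trivial⟩
  · rintro ⟨e, k, l'⟩ h
    simp only [mem_filter, mem_timedArcs, timedHead, Prod.mk.injEq] at h
    simp only [mem_product, mem_filter, mem_univ, true_and]
    exact ⟨⟨h.1.1, h.2.1⟩, by omega⟩
  · rintro ⟨e, k⟩ _
    rfl
  · rintro ⟨e, k, l'⟩ h
    simp only [mem_filter, mem_timedArcs, timedHead, Prod.mk.injEq] at h
    simp only [Prod.mk.injEq, true_and]
    omega
  · rintro ⟨e, k⟩ _
    rfl

theorem sum_level_eq [DecidableEq V] (F : (V × V) × Fin (K + 1) × ℕ → ℝ) {e : V × V}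
    (he : e ∈ E) (k : Fin (K + 1)) :
    ∑ l ∈ Finset.Icc (k : ℕ) M, F (e, k, l)
    = ∑ x ∈ (timedArcs E K M).filter (fun x => x.1 = e ∧ x.2.1 = k), F x := by
  refine Finset.sum_nbij' (fun l => (e, k, l)) (fun x => x.2.2) ?_ ?_ ?_ ?_ ?_
  · intro l h
    simpa [mem_timedArcs, he] using h
  · rintro ⟨e', k', l⟩ h
    simp only [mem_filter, mem_timedArcs] at h
    obtain ⟨h, rfl, rfl⟩ := h
    simpa using h.2
  · intro l _
    rfl
  · rintro ⟨e', k', l⟩ h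
    simp only [mem_filter] at h
    obtain ⟨h, rfl, rfl⟩ := h
    rfl
  · intro l _
    rfl

theorem sum_duration_level_eq [DecidableEq V] (F : (V × V) × Fin (K + 1) × ℕ → ℝ) {e : V × V}
    (he : e ∈ E) :
    ∑ k : Fin (K + 1), ∑ l ∈ Finset.Icc (k : ℕ) M, F (e, k, l)
    = ∑ x ∈ (timedArcs E K M).filter (fun x => x.1 = e), F x := by
  simp only [sum_level_eq F he]
  rw [← Finset.sum_fiberwise (s := (timedArcs E K M).filter (fun x => x.1 = e))
    (g := fun x => x.2.1)]
  simp only [Finset.filter_filter]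

theorem timedArcs_rank {ord : V → ℕ} (hord : ∀ e ∈ E, ord e.1 < ord e.2) :
    ∀ x ∈ timedArcs E K M, ord (timedTail x).1 < ord (timedHead x).1 :=
  fun x hx => hord x.1 (mem_timedArcs.1 hx).1

theorem IsArcPath.map_fst {v : V × ℕ} {X : List ((V × V) × Fin (K + 1) × ℕ)}
    (hX : IsArcPath (timedArcs E K M) timedTail timedHead (fun v => v.1 = t) v X) :
    IsArcPath E Prod.fst Prod.snd (· = t) v.1 (X.map Prod.fst) := by
  induction X generalizing v with
  | nil => exact hX
  | cons x X ih =>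
    obtain ⟨hx, rfl, hT, hX⟩ := hX
    exact ⟨(mem_timedArcs.1 hx).1, rfl, hT, ih hX⟩

/-- A path all of whose arcs into the sink arrive at level `r` or later has length at least `r`
when measured from level `0`. -/
theorem IsArcPath.le_add_sum {r : ℕ} {v : V × ℕ} {X : List ((V × V) × Fin (K + 1) × ℕ)}
    (hX : IsArcPath (timedArcs E K M) timedTail timedHead (fun v => v.1 = t) v X)
    (hr : ∀ x ∈ X, x.1.2 = t → r ≤ x.2.2) (hv : v.1 = t → r ≤ v.2) :
    r ≤ v.2 + (X.map fun x => (x.2.1 : ℕ)).sum := by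
  induction X generalizing v with
  | nil => simpa using hv hX
  | cons x X ih =>
    obtain ⟨hx, rfl, -, hX⟩ := hX
    have h := ih hX (fun y hy => hr y (by simp [hy])) (hr x (by simp))
    have h' := (mem_timedArcs.1 hx).2.1
    simp only [timedTail, timedHead, List.map_cons, List.sum_cons] at h ⊢
    omega

/-- The lift of a list of edges with durations `c` to the time-expanded network, starting at
level `l`. -/
def timedLift (c : V × V → Fin (K + 1)) : ℕ → List (V × V) → List ((V × V) × Fin (K + 1) × ℕ)
  | _, [] => []
  | l, e :: Q => (e, c e, l + (c e : ℕ)) :: timedLift c (l + (c e : ℕ)) Q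

theorem timedLift_duration (c : V × V → Fin (K + 1)) (l : ℕ) (Q : List (V × V)) :
    ∀ x ∈ timedLift c l Q, x.2.1 = c x.1 := by
  induction Q generalizing l with
  | nil => simp [timedLift]
  | cons e Q ih => simpa [timedLift] using fun a b d h => ih _ (a, b, d) h

theorem IsArcPath.timedLift (c : V × V → Fin (K + 1)) {l : ℕ} {u : V} {Q : List (V × V)}
    (hQ : IsArcPath E Prod.fst Prod.snd (· = t) u Q)
    (hM : l + (Q.map fun e => (c e : ℕ)).sum ≤ M) :
    IsArcPath (timedArcs E K M) timedTail timedHead (fun v => v.1 = t) (u, l)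
      (timedLift c l Q) := by
  induction Q generalizing u l with
  | nil => exact hQ
  | cons e Q ih =>
    obtain ⟨he, rfl, hT, hQ⟩ := hQ
    simp only [List.map_cons, List.sum_cons] at hM
    refine ⟨mem_timedArcs.2 ⟨he, by simp, show l + (c e : ℕ) ≤ M by omega⟩, by simp [timedTail], hT, ?_⟩
    exact ih (l := l + (c e : ℕ)) hQ (by omega)

theorem IsArcPath.timedLift_level (c : V × V → Fin (K + 1)) {l : ℕ} {u : V} {Q : List (V × V)}
    (hQ : IsArcPath E Prod.fst Prod.snd (· = t) u Q) :
    ∀ x ∈ _root_.timedLift c l Q, x.1.2 = t →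
      x.2.2 = l + (Q.map fun e => (c e : ℕ)).sum := by
  induction Q generalizing u l with
  | nil => simp [_root_.timedLift]
  | cons e Q ih =>
    obtain ⟨he, rfl, hT, hQ⟩ := hQ
    intro x hx hxt
    rcases List.mem_cons.1 hx with rfl | hx
    · cases Q with
      | nil => simp
      | cons f Q => exact absurd hxt hQ.2.2.1
    · rw [ih hQ x hx hxt]
      simp [add_assoc]

theorem IsArcPath.sum_le {ord : V → ℕ} (hord : ∀ e ∈ E, ord e.1 < ord e.2)
    (c : V × V → Fin (K + 1)) {u : V} {Q : List (V × V)}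
    (hQ : IsArcPath E Prod.fst Prod.snd (· = t) u Q) :
    (Q.map fun e => (c e : ℕ)).sum ≤ E.card * K := by
  have hnodup : Q.Nodup := List.Nodup.of_map _ (hQ.nodup_map_src hord)
  have hlen : Q.length ≤ E.card := by
    rw [← List.toFinset_card_of_nodup hnodup]
    exact Finset.card_le_card fun e he => hQ.mem e (by simpa using he)
  have h : (Q.map fun e => (c e : ℕ)).sum ≤ (Q.map fun e => (c e : ℕ)).length • K := by
    refine List.sum_le_card_nsmul _ _ fun a ha => ?_
    obtain ⟨e, -, rfl⟩ := List.mem_map.1 ha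
    omega
  rw [List.length_map, smul_eq_mul] at h
  exact h.trans (Nat.mul_le_mul_right K hlen)

/-- A path in the time-expanded network uses every edge at most once. -/
theorem IsArcPath.nodup_map_fst {ord : V → ℕ} (hord : ∀ e ∈ E, ord e.1 < ord e.2)
    {v : V × ℕ} {X : List ((V × V) × Fin (K + 1) × ℕ)}
    (hX : IsArcPath (timedArcs E K M) timedTail timedHead (fun v => v.1 = t) v X) :
    (X.map Prod.fst).Nodup :=
  List.Nodup.of_map _ (hX.map_fst.nodup_map_src hord)

theorem IsArcPath.countP_edge [DecidableEq V] {ord : V → ℕ}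
    (hord : ∀ e ∈ E, ord e.1 < ord e.2)
    {v : V × ℕ} {X : List ((V × V) × Fin (K + 1) × ℕ)}
    (hX : IsArcPath (timedArcs E K M) timedTail timedHead (fun v => v.1 = t) v X) (e : V × V) :
    X.countP (fun x => x.1 = e) = if e ∈ X.map Prod.fst then 1 else 0 := by
  rw [← (hX.nodup_map_fst hord).count, List.count, List.countP_map]
  refine List.countP_congr fun x _ => ?_
  simp

end TimeExpansion

section Mixture

/-- The probability weights proportional to `u`; the point mass at `0` if `u` has total `0`. -/
noncomputable def normalizedWeights {K : ℕ} (u : Fin (K + 1) → ℝ) (k : Fin (K + 1)) : ℝ :=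
  if ∑ i, u i = 0 then (if k = 0 then 1 else 0) else u k / ∑ i, u i

theorem normalizedWeights_nonneg {K : ℕ} {u : Fin (K + 1) → ℝ} (hu : ∀ k, 0 ≤ u k)
    (k : Fin (K + 1)) : 0 ≤ normalizedWeights u k := by
  unfold normalizedWeights
  split_ifs
  · exact zero_le_one
  · exact le_rfl
  · exact div_nonneg (hu k) (Finset.sum_nonneg fun i _ => hu i)

theorem sum_normalizedWeights {K : ℕ} (u : Fin (K + 1) → ℝ) :
    ∑ k, normalizedWeights u k = 1 := by
  unfold normalizedWeights
  split_ifs with h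
  · simp
  · rw [← Finset.sum_div, div_self h]

theorem sum_mul_normalizedWeights {K : ℕ} {u : Fin (K + 1) → ℝ} (hu : ∀ k, 0 ≤ u k)
    (k : Fin (K + 1)) : (∑ i, u i) * normalizedWeights u k = u k := by
  unfold normalizedWeights
  split_ifs with h h'
  · rw [h, zero_mul, (Finset.sum_eq_zero_iff_of_nonneg fun i _ => hu i).1 h k (mem_univ k)]
  · rw [h, zero_mul, (Finset.sum_eq_zero_iff_of_nonneg fun i _ => hu i).1 h k (mem_univ k)]
  · exact mul_div_cancel₀ _ h

variable {V : Type*} [DecidableEq V] {E : Finset (V × V)} {s t : V} {K M : ℕ}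

/-- Number of times the timed path `X` runs through the edge `e` with duration `k`. -/
noncomputable def occupation (M : ℕ) (X : List ((V × V) × Fin (K + 1) × ℕ)) (e : V × V)
    (k : Fin (K + 1)) : ℝ :=
  ∑ l ∈ Finset.Icc (k : ℕ) M, (X.count (e, k, l) : ℝ)

theorem occupation_nonneg (X : List ((V × V) × Fin (K + 1) × ℕ)) (e : V × V)
    (k : Fin (K + 1)) : 0 ≤ occupation M X e k :=
  Finset.sum_nonneg fun _ _ => Nat.cast_nonneg _

theorem exists_mem_of_occupation_ne_zero {X : List ((V × V) × Fin (K + 1) × ℕ)} {e : V × V}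
    {k : Fin (K + 1)} (h : occupation M X e k ≠ 0) : ∃ l, (e, k, l) ∈ X := by
  obtain ⟨l, -, hl⟩ := Finset.exists_ne_zero_of_sum_ne_zero h
  exact ⟨l, List.count_pos_iff.1 (Nat.pos_of_ne_zero (by simpa using hl))⟩

theorem occupation_eq_zero {X : List ((V × V) × Fin (K + 1) × ℕ)} {e : V × V}
    (he : e ∉ X.map Prod.fst) (k : Fin (K + 1)) : occupation M X e k = 0 := by
  by_contra h
  obtain ⟨l, hl⟩ := exists_mem_of_occupation_ne_zero h
  exact he (List.mem_map.2 ⟨_, hl, rfl⟩)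

theorem IsArcPath.sum_occupation {ord : V → ℕ} (hord : ∀ e ∈ E, ord e.1 < ord e.2)
    {v : V × ℕ} {X : List ((V × V) × Fin (K + 1) × ℕ)}
    (hX : IsArcPath (timedArcs E K M) timedTail timedHead (fun v => v.1 = t) v X) (e : V × V) :
    ∑ k, occupation M X e k = if e ∈ X.map Prod.fst then 1 else 0 := by
  by_cases he : e ∈ E
  · unfold occupation
    rw [sum_duration_level_eq (fun x => (X.count x : ℝ)) he, sum_filter_count hX.mem,
      hX.countP_edge hord]
    split_ifs <;> simp
  · have he' : e ∉ X.map Prod.fst := fun h => he (hX.map_fst.mem e h)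
    simp [occupation_eq_zero he', he']

/-- Along the durations a timed path prescribes, the underlying path is a long `s`–`t` path. -/
theorem IsArcPath.exists_long_dipath {ord : V → ℕ} (hord : ∀ e ∈ E, ord e.1 < ord e.2)
    (hst : s ≠ t) {r : ℕ} {X : List ((V × V) × Fin (K + 1) × ℕ)}
    (hX : IsArcPath (timedArcs E K M) timedTail timedHead (fun v => v.1 = t) (s, 0) X)
    (hr : ∀ x ∈ X, x.1.2 = t → r ≤ x.2.2) {c : V × V → Fin (K + 1)}
    (hc : ∀ e ∈ X.map Prod.fst, occupation M X e (c e) ≠ 0) :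
    ∃ Q : List (V × V), IsDipath E s t Q ∧ r ≤ (Q.map fun e => (c e : ℕ)).sum := by
  refine ⟨X.map Prod.fst, hX.map_fst.isDipath hst hord, ?_⟩
  have h := hX.le_add_sum hr (fun h => absurd h hst)
  rw [zero_add] at h
  refine h.trans_eq ?_
  rw [List.map_map]
  congr 1
  refine List.map_congr_left fun x hx => ?_
  obtain ⟨l, hl⟩ := exists_mem_of_occupation_ne_zero (hc x.1 (List.mem_map.2 ⟨x, hx, rfl⟩))
  have := List.inj_on_of_nodup_map (hX.nodup_map_fst hord) hl hx rfl
  exact congrArg (fun y => (y.2.1 : ℕ)) this.symm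

variable [Fintype V]

/-- Weighted timed paths, together with the marginals `g` of the durations off the paths and the
marginals `h` of the remaining mass, are realized by a joint distribution of the durations. -/
theorem exists_joint_of_paths {ord : V → ℕ} (hord : ∀ e ∈ E, ord e.1 < ord e.2)
    (hst : s ≠ t) {r m : ℕ} {w : Fin m → ℝ} {X : Fin m → List ((V × V) × Fin (K + 1) × ℕ)}
    (hw : ∀ j, 0 ≤ w j)
    (hX : ∀ j, IsArcPath (timedArcs E K M) timedTail timedHead (fun v => v.1 = t) (s, 0) (X j))
    (hr : ∀ j, ∀ x ∈ X j, x.1.2 = t → r ≤ x.2.2) {b : ℝ} {h g : V × V → Fin (K + 1) → ℝ}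
    (hb : 0 ≤ b) (hh : ∀ e k, 0 ≤ h e k) (hg : ∀ e k, 0 ≤ g e k)
    (hbh : ∀ e ∈ E, ∑ k, h e k = b)
    (hwg : ∀ e ∈ E, ∑ k, g e k = ∑ j, if e ∈ (X j).map Prod.fst then 0 else w j)
    (htot : b + ∑ j, w j = 1) :
    ∃ θ : (V × V → Fin (K + 1)) → ℝ, (∀ c, 0 ≤ θ c) ∧ ∑ c, θ c = 1 ∧
      (∀ e ∈ E, ∀ k, ∑ c ∈ univ.filter (fun c : V × V → Fin (K + 1) => c e = k), θ c
        = h e k + g e k + ∑ j, w j * occupation M (X j) e k) ∧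
      ∑ j, w j ≤ ∑ c ∈ univ.filter (fun c : V × V → Fin (K + 1) =>
        ∃ Q : List (V × V), IsDipath E s t Q ∧ r ≤ (Q.map fun e => (c e : ℕ)).sum), θ c := by
  set q : Fin m → V × V → Fin (K + 1) → ℝ := fun j e k =>
    if e ∈ (X j).map Prod.fst then occupation M (X j) e k else normalizedWeights (g e) k with hq
  have hq0 : ∀ j e k, 0 ≤ q j e k := by
    intro j e k
    simp only [hq]
    split_ifs
    · exact occupation_nonneg _ _ _
    · exact normalizedWeights_nonneg (hg e) k
  have hq1 : ∀ j e, ∑ k, q j e k = 1 := by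
    intro j e
    simp only [hq]
    split_ifs with he
    · rw [(hX j).sum_occupation hord, if_pos he]
    · exact sum_normalizedWeights _
  have hn1 : ∀ e, ∑ k, normalizedWeights (h e) k = 1 := fun e => sum_normalizedWeights _
  have hprod : ∀ c : V × V → Fin (K + 1), 0 ≤ b * ∏ e, normalizedWeights (h e) (c e) :=
    fun c => mul_nonneg hb (Finset.prod_nonneg fun e _ => normalizedWeights_nonneg (hh e) _)
  have hprod' : ∀ c : V × V → Fin (K + 1), ∀ j, 0 ≤ w j * ∏ e, q j e (c e) :=
    fun c j => mul_nonneg (hw j) (Finset.prod_nonneg fun e _ => hq0 j e _)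
  refine ⟨fun c => b * ∏ e, normalizedWeights (h e) (c e) + ∑ j, w j * ∏ e, q j e (c e),
    fun c => add_nonneg (hprod c) (Finset.sum_nonneg fun j _ => hprod' c j), ?_, ?_, ?_⟩
  · rw [Finset.sum_add_distrib, ← Finset.mul_sum, sum_prod_eq_one hn1, Finset.sum_comm]
    simp only [← Finset.mul_sum, sum_prod_eq_one (hq1 _), mul_one]
    exact htot
  · intro e he k
    rw [Finset.sum_add_distrib, ← Finset.mul_sum, sum_prod_marginal hn1, Finset.sum_comm]
    simp only [← Finset.mul_sum, sum_prod_marginal (hq1 _)]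
    have hsplit : ∀ j, w j * q j e k = (if e ∈ (X j).map Prod.fst then 0 else w j)
        * normalizedWeights (g e) k + w j * occupation M (X j) e k := by
      intro j
      simp only [hq]
      split_ifs with hej
      · ring
      · rw [occupation_eq_zero hej]
        ring
    simp only [hsplit, Finset.sum_add_distrib, ← Finset.sum_mul]
    rw [← hwg e he, sum_mul_normalizedWeights (hg e), ← hbh e he,
      sum_mul_normalizedWeights (hh e), add_assoc]
  · rw [Finset.sum_add_distrib, Finset.sum_comm]
    simp only [← Finset.mul_sum]
    have hone : ∀ j, ∑ c ∈ univ.filter (fun c : V × V → Fin (K + 1) =>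
        ∃ Q : List (V × V), IsDipath E s t Q ∧ r ≤ (Q.map fun e => (c e : ℕ)).sum),
          ∏ e, q j e (c e) = 1 := by
      intro j
      rw [← sum_prod_eq_one (hq1 j)]
      refine Finset.sum_subset (Finset.filter_subset _ _) fun c _ hc => ?_
      by_contra hne
      refine hc (mem_filter.2 ⟨mem_univ c, (hX j).exists_long_dipath hord hst (hr j) ?_⟩)
      intro e he
      have := Finset.prod_ne_zero_iff.1 hne e (mem_univ e)
      simpa only [hq, if_pos he] using this
    simp only [hone, mul_one]
    refine le_add_of_nonneg_left (mul_nonneg hb (Finset.sum_nonneg fun c _ => ?_))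
    exact Finset.prod_nonneg fun e _ => normalizedWeights_nonneg (hh e) _

end Mixture

section PathFlow

theorem IsArcPath.exists_stop_rank_ge {α N : Type*} {A : Finset α} {src dst : α → N}
    {T : N → Prop} {rank : N → ℕ} (hrank : ∀ x ∈ A, rank (src x) < rank (dst x)) {v : N}
    {X : List α} (hX : IsArcPath A src dst T v X) : ∃ u, T u ∧ rank v ≤ rank u := by
  induction X generalizing v with
  | nil => exact ⟨v, hX, le_rfl⟩
  | cons y X ih =>
    obtain ⟨hy, rfl, -, hX⟩ := hX
    obtain ⟨u, hu, h⟩ := ih hX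
    exact ⟨u, hu, (hrank y hy).le.trans h⟩

theorem sum_filter_sum_mul_count {α ι : Type*} [BEq α] [LawfulBEq α] {A : Finset α}
    {p : α → Prop} [DecidablePred p] {J : Finset ι} {w : ι → ℝ} {X : ι → List α}
    (hX : ∀ j ∈ J, ∀ x ∈ X j, x ∈ A) :
    ∑ x ∈ A.filter p, ∑ j ∈ J, w j * ((X j).count x : ℝ)
      = ∑ j ∈ J, w j * ((X j).countP p : ℝ) := by
  rw [Finset.sum_comm]
  refine Finset.sum_congr rfl fun j hj => ?_
  rw [← Finset.mul_sum, sum_filter_count (hX j hj)]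

variable {V : Type*} {E : Finset (V × V)} {s t : V} {K M r : ℕ}

theorem IsDipath.exists_timed_path {ord : V → ℕ} (hord : ∀ e ∈ E, ord e.1 < ord e.2)
    (hst : s ≠ t) {c : V × V → Fin (K + 1)} {Q : List (V × V)} (hQ : IsDipath E s t Q)
    (hr : r ≤ (Q.map fun e => (c e : ℕ)).sum) :
    ∃ X : List ((V × V) × Fin (K + 1) × ℕ),
      IsArcPath (timedArcs E K (E.card * K)) timedTail timedHead (fun v => v.1 = t) (s, 0) X ∧
      (∀ x ∈ X, x.2.1 = c x.1) ∧ ∀ x ∈ X, x.1.2 = t → r ≤ x.2.2 := by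
  have hQ' := hQ.isArcPath hst
  refine ⟨timedLift c 0 Q, hQ'.timedLift c (by simpa using hQ'.sum_le hord c),
    timedLift_duration c 0 Q, fun x hx hxt => ?_⟩
  rw [hQ'.timedLift_level c x hx hxt, zero_add]
  exact hr

variable [DecidableEq V]

theorem IsArcPath.sum_countP_head (hst : s ≠ t) {X : List ((V × V) × Fin (K + 1) × ℕ)}
    (hX : IsArcPath (timedArcs E K M) timedTail timedHead (fun v => v.1 = t) (s, 0) X)
    (hr : ∀ x ∈ X, x.1.2 = t → r ≤ x.2.2) :
    ∑ l ∈ Finset.Icc r M, (X.countP (fun x => timedHead x = (t, l)) : ℝ) = 1 := by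
  have hlevel : ∀ x ∈ X, x.1.2 = t → x.2.2 ∈ Finset.Icc r M := fun x hx hxt =>
    Finset.mem_Icc.2 ⟨hr x hx hxt, (mem_timedArcs.1 (hX.mem x hx)).2.2⟩
  have hone := hX.countP_stop
  rw [if_neg hst] at hone
  rw [← Nat.cast_sum, Nat.cast_eq_one]
  refine Eq.trans ?_ hone
  clear hX hr hone
  induction X with
  | nil => simp
  | cons y X ih =>
    simp only [List.countP_cons, Finset.sum_add_distrib]
    rw [ih fun x hx => hlevel x (by simp [hx])]
    congr 1
    have hy := hlevel y (by simp)
    by_cases h : y.1.2 = t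
    · have := Finset.mem_Icc.1 (hy h)
      simp [timedHead, h, this]
    · simp [timedHead, h]

theorem IsArcPath.occupation_le {ord : V → ℕ} (hord : ∀ e ∈ E, ord e.1 < ord e.2)
    {v : V × ℕ} {X : List ((V × V) × Fin (K + 1) × ℕ)}
    (hX : IsArcPath (timedArcs E K M) timedTail timedHead (fun v => v.1 = t) v X)
    {c : V × V → Fin (K + 1)} (hc : ∀ x ∈ X, x.2.1 = c x.1) (e : V × V) (k : Fin (K + 1)) :
    occupation M X e k ≤ if c e = k then 1 else 0 := by
  split_ifs with hk
  · refine (Finset.single_le_sum (fun k _ => occupation_nonneg X e k) (mem_univ k)).trans ?_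
    rw [hX.sum_occupation hord]
    split_ifs <;> norm_num
  · by_contra h
    obtain ⟨l, hl⟩ := exists_mem_of_occupation_ne_zero (fun h' => h h'.le)
    exact hk (hc _ hl).symm

/-- A timed path from `(s, 0)` leaves `s` only at level `0`. -/
theorem IsArcPath.countP_tail_start {ord : V → ℕ} (hord : ∀ e ∈ E, ord e.1 < ord e.2)
    (hst : s ≠ t) {X : List ((V × V) × Fin (K + 1) × ℕ)}
    (hX : IsArcPath (timedArcs E K M) timedTail timedHead (fun v => v.1 = t) (s, 0) X)
    {l : ℕ} (hl : l ≠ 0) : X.countP (fun x => timedTail x = (s, l)) = 0 := by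
  rw [hX.countP_src (u := (s, l)) hst, if_neg (by simp [hl]), add_zero, List.countP_eq_zero]
  intro x hx
  have h1 := hX.rank_le (rank := fun v => ord v.1) (timedArcs_rank hord) x hx
  have h2 := timedArcs_rank hord x (hX.mem x hx)
  simp only [decide_eq_true_eq]
  intro h
  simp only [h] at h1 h2
  omega

end PathFlow

/-- Compact LP for PERT networks: the tightest upper bound
`U^pert(r) = max_{θ ∈ Θ} P_θ(Z^pert(c̃) ≥ r)` on the probability that the project
completion time (the longest `s`–`t` path length) is at least `r`, over all joint
distributions of the activity durations consistent with the given marginals on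
`{0,…,K}`, equals the optimal value of the stated linear program. -/
theorem pert_compact_LP {V : Type*} [Fintype V] [DecidableEq V]
    (E : Finset (V × V)) (s t : V) (hst : s ≠ t)
    (ord : V → ℕ) (hord : ∀ e ∈ E, ord e.1 < ord e.2)
    (hpath : ∃ P : List (V × V), IsDipath E s t P)
    (n : ℕ) (hn : E.card = n) (K : ℕ) (hK : 0 < K)
    (r : ℕ) (hr : r ≤ n * K)
    (p : V × V → Fin (K + 1) → ℝ)
    (hp0 : ∀ e ∈ E, ∀ k, 0 ≤ p e k) (hp1 : ∀ e ∈ E, (∑ k, p e k) = 1) :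
    sSup {P : ℝ | ∃ θ : (V × V → Fin (K + 1)) → ℝ,
        (∀ c, 0 ≤ θ c) ∧ (∑ c, θ c) = 1 ∧
        (∀ e ∈ E, ∀ k, ∑ c ∈ univ.filter (fun c : V × V → Fin (K + 1) => c e = k), θ c
          = p e k) ∧
        P = ∑ c ∈ univ.filter (fun c : V × V → Fin (K + 1) =>
            ∃ Q : List (V × V), IsDipath E s t Q ∧
              r ≤ (Q.map fun e => (c e : ℕ)).sum), θ c}
    = sSup {W : ℝ | ∃ (a b : ℝ) (h g : V × V → Fin (K + 1) → ℝ)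
        (δ : V × V → Fin (K + 1) → ℕ → ℝ) (τ : ℕ → ℝ),
        0 ≤ a ∧ 0 ≤ b ∧ (∀ e k, 0 ≤ h e k) ∧ (∀ e k, 0 ≤ g e k) ∧
        (∀ e k l, 0 ≤ δ e k l) ∧ (∀ l, 0 ≤ τ l) ∧
        a + b = 1 ∧
        (∀ e ∈ E, (∑ k, h e k) = b) ∧
        (∀ e ∈ E, (∑ k, g e k) +
            (∑ k : Fin (K + 1), ∑ l ∈ Finset.Icc (k : ℕ) (n * K), δ e k l) = a) ∧
        (∀ e ∈ E, ∀ k, h e k + g e k +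
            (∑ l ∈ Finset.Icc (k : ℕ) (n * K), δ e k l) = p e k) ∧
        a = (∑ l ∈ Finset.Icc r (n * K), τ l) ∧
        (∀ l ∈ Finset.Icc r (n * K), τ l =
            ∑ e ∈ E.filter (fun e => e.2 = t),
              ∑ k ∈ univ.filter (fun k : Fin (K + 1) => (k : ℕ) ≤ l), δ e k l) ∧
        (∀ i : V, i ≠ s → i ≠ t → ∀ l ≤ n * K,
            (∑ e ∈ E.filter (fun e => e.1 = i),
              ∑ k ∈ univ.filter (fun k : Fin (K + 1) => (k : ℕ) ≤ n * K - l),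
                δ e k (l + (k : ℕ)))
            = ∑ e ∈ E.filter (fun e => e.2 = i),
                ∑ k ∈ univ.filter (fun k : Fin (K + 1) => (k : ℕ) ≤ l), δ e k l) ∧
        (∀ l < r,
            (∑ e ∈ E.filter (fun e => e.2 = t),
              ∑ k ∈ univ.filter (fun k : Fin (K + 1) => (k : ℕ) ≤ l), δ e k l) = 0) ∧
        (∀ l ∈ Finset.Icc 1 (n * K),
            (∑ e ∈ E.filter (fun e => e.1 = s),
              ∑ k ∈ univ.filter (fun k : Fin (K + 1) => (k : ℕ) ≤ n * K - l),
                δ e k (l + (k : ℕ))) = 0) ∧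
        W = a} := by
  subst hn
  set M := E.card * K
  have hrank := timedArcs_rank (K := K) (M := M) hord
  refine csSup_eq_csSup_of_forall_exists_le ?_ ?_
  · rintro _ ⟨θ, hθ0, hθ1, hθp, rfl⟩
    set B := univ.filter (fun c : V × V → Fin (K + 1) =>
      ∃ Q : List (V × V), IsDipath E s t Q ∧ r ≤ (Q.map fun e => (c e : ℕ)).sum)
    have hex : ∀ c, ∃ X : List ((V × V) × Fin (K + 1) × ℕ), c ∈ B →
        IsArcPath (timedArcs E K M) timedTail timedHead (fun v => v.1 = t) (s, 0) X ∧
        (∀ x ∈ X, x.2.1 = c x.1) ∧ ∀ x ∈ X, x.1.2 = t → r ≤ x.2.2 := by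
      intro c
      by_cases hc : c ∈ B
      · obtain ⟨-, Q, hQ, hr⟩ := mem_filter.1 hc
        obtain ⟨X, hX⟩ := hQ.exists_timed_path hord hst hr
        exact ⟨X, fun _ => hX⟩
      · exact ⟨[], fun h => absurd h hc⟩
    choose X hX using hex
    have hmem : ∀ c ∈ B, ∀ x ∈ X c, x ∈ timedArcs E K M := fun c hc => (hX c hc).1.mem
    set F : (V × V) × Fin (K + 1) × ℕ → ℝ := fun x => ∑ c ∈ B, θ c * ((X c).count x : ℝ) with hF
    have hF0 : ∀ x, 0 ≤ F x := fun x =>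
      Finset.sum_nonneg fun c _ => mul_nonneg (hθ0 c) (Nat.cast_nonneg _)
    have hocc : ∀ (e : V × V) (k : Fin (K + 1)), ∑ l ∈ Finset.Icc (k : ℕ) M, F (e, k, l)
        = ∑ c ∈ B, θ c * occupation M (X c) e k := by
      intro e k
      simp only [hF, occupation, Finset.mul_sum]
      exact Finset.sum_comm
    have hin : ∀ i : V, ∀ l ≤ M, ∑ e ∈ E.filter (fun e => e.2 = i),
        ∑ k ∈ univ.filter (fun k : Fin (K + 1) => (k : ℕ) ≤ l), F (e, k, l)
        = ∑ c ∈ B, θ c * ((X c).countP (fun x => timedHead x = (i, l)) : ℝ) := by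
      intro i l hl
      rw [sum_in_eq F i hl, sum_filter_sum_mul_count hmem]
    have hout : ∀ i : V, ∀ l ≤ M, ∑ e ∈ E.filter (fun e => e.1 = i),
        ∑ k ∈ univ.filter (fun k : Fin (K + 1) => (k : ℕ) ≤ M - l), F (e, k, l + (k : ℕ))
        = ∑ c ∈ B, θ c * ((X c).countP (fun x => timedTail x = (i, l)) : ℝ) := by
      intro i l hl
      rw [sum_out_eq F i hl, sum_filter_sum_mul_count hmem]
    refine ⟨_, ⟨∑ c ∈ B, θ c, ∑ c ∈ Bᶜ, θ c,
      fun e k => ∑ c ∈ Bᶜ, θ c * (if c e = k then 1 else 0),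
      fun e k => ∑ c ∈ B, θ c * ((if c e = k then 1 else 0) - occupation M (X c) e k),
      fun e k l => F (e, k, l),
      fun l => ∑ e ∈ E.filter (fun e => e.2 = t),
        ∑ k ∈ univ.filter (fun k : Fin (K + 1) => (k : ℕ) ≤ l), F (e, k, l),
      Finset.sum_nonneg fun c _ => hθ0 c, Finset.sum_nonneg fun c _ => hθ0 c,
      fun e k => Finset.sum_nonneg fun c _ => mul_nonneg (hθ0 c) (by split_ifs <;> norm_num),
      fun e k => Finset.sum_nonneg fun c hc => mul_nonneg (hθ0 c)
        (sub_nonneg.2 ((hX c hc).1.occupation_le hord (hX c hc).2.1 e k)),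
      fun e k l => hF0 _,
      fun l => Finset.sum_nonneg fun e _ => Finset.sum_nonneg fun k _ => hF0 _,
      ?_, ?_, ?_, ?_, ?_, fun l _ => rfl, ?_, ?_, ?_, rfl⟩, le_rfl⟩
    · rw [Finset.sum_add_sum_compl, hθ1]
    · intro e _
      rw [Finset.sum_comm]
      simp
    · intro e _
      simp only [hocc]
      rw [← Finset.sum_add_distrib]
      simp only [← Finset.sum_add_distrib, ← mul_add, sub_add_cancel]
      rw [Finset.sum_comm]
      simp
    · intro e he k
      rw [hocc, add_assoc, ← Finset.sum_add_distrib]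
      simp only [← mul_add, sub_add_cancel]
      rw [add_comm, Finset.sum_add_sum_compl, ← hθp e he k, Finset.sum_filter]
      simp
    · rw [Finset.sum_congr rfl fun l hl => hin t l (Finset.mem_Icc.1 hl).2, Finset.sum_comm]
      refine Finset.sum_congr rfl fun c hc => ?_
      rw [← Finset.mul_sum, (hX c hc).1.sum_countP_head hst (hX c hc).2.2, mul_one]
    · intro i his hit l hl
      rw [hin i l hl, hout i l hl]
      refine Finset.sum_congr rfl fun c hc => ?_
      rw [(hX c hc).1.countP_src (u := (i, l)) hit]
      simp [his]
    · intro l hl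
      rw [hin t l (hl.le.trans hr)]
      refine Finset.sum_eq_zero fun c hc => ?_
      have : (X c).countP (fun x => timedHead x = (t, l)) = 0 := by
        rw [List.countP_eq_zero]
        intro x hx h
        simp only [decide_eq_true_eq, timedHead, Prod.mk.injEq] at h
        have := (hX c hc).2.2 x hx h.1
        omega
      simp [this]
    · intro l hl
      obtain ⟨hl1, hl2⟩ := Finset.mem_Icc.1 hl
      rw [hout s l hl2]
      refine Finset.sum_eq_zero fun c hc => ?_
      simp [(hX c hc).1.countP_tail_start hord hst (show l ≠ 0 by omega)]
  · rintro a ⟨_, b, h, g, δ, τ, -, hb, hh, hg, hδ, -, hab, hbh, hga, hp, haτ, hτ, hflow, hsink,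
      hsource, rfl⟩
    set f : (V × V) × Fin (K + 1) × ℕ → ℝ := fun x => δ x.1 x.2.1 x.2.2 with hf
    have hf0 : ∀ x ∈ timedArcs E K M, 0 ≤ f x := fun x _ => hδ _ _ _
    have hcons : ∀ v : V × ℕ, ¬ v.1 = s → ¬ v.1 = t →
        ∑ x ∈ (timedArcs E K M).filter (fun x => timedTail x = v), f x
          = ∑ x ∈ (timedArcs E K M).filter (fun x => timedHead x = v), f x := by
      rintro ⟨i, l⟩ his hit
      by_cases hl : l ≤ M
      · rw [← sum_out_eq f i hl, ← sum_in_eq f i hl]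
        exact hflow i his hit l hl
      · rw [Finset.filter_false_of_mem, Finset.filter_false_of_mem]
        · intro x hx h
          have := (mem_timedArcs.1 hx).2.2
          simp only [timedHead, Prod.mk.injEq] at h
          omega
        · intro x hx h
          have := (mem_timedArcs.1 hx).2.2
          simp only [timedTail, Prod.mk.injEq] at h
          omega
    have hord_st : ord s ≤ ord t := by
      obtain ⟨P, hP⟩ := hpath
      obtain ⟨u, rfl, hu⟩ := (hP.isArcPath hst).exists_stop_rank_ge (rank := ord) hord
      exact hu
    obtain ⟨m, w, X, hw, hX, hdec⟩ := exists_path_decomposition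
      (rank := fun v : V × ℕ => ord v.1) (S := fun v => v.1 = s) (T := fun v => v.1 = t)
      hrank hf0 hcons
      (fun x hx hxs => eq_zero_of_dst_start (rank := fun v : V × ℕ => ord v.1) (ρ := ord s)
        hrank hf0 hcons (fun v hv => congrArg ord hv) (fun v hv => hv ▸ hord_st) hx hxs)
      (fun x hx hxt => eq_zero_of_src_stop (rank := fun v : V × ℕ => ord v.1) (ρ := ord t)
        hrank hf0 hcons (fun v hv => hv ▸ hord_st) (fun v hv => congrArg ord hv) hx hxt)
    have hX' : ∀ j, IsArcPath (timedArcs E K M) timedTail timedHead (fun v => v.1 = t)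
        (s, 0) (X j) := by
      intro j
      obtain ⟨⟨⟨i, l⟩, hi, hpathj⟩, hpos⟩ := hX j
      obtain rfl : i = s := hi
      suffices hl0 : l = 0 by rwa [hl0] at hpathj
      by_contra hl0
      cases hXj : X j with
      | nil => rw [hXj] at hpathj; exact hst hpathj
      | cons x Y =>
        rw [hXj] at hpathj hpos
        obtain ⟨hx, htail, -, -⟩ := hpathj
        have hlM : l ≤ M := by
          have := (mem_timedArcs.1 hx).2.2
          simp only [timedTail, Prod.mk.injEq] at htail
          omega
        have hzero := hsource l (Finset.mem_Icc.2 ⟨by omega, hlM⟩)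
        rw [sum_out_eq f i hlM, Finset.sum_eq_zero_iff_of_nonneg
          fun x hx => hf0 x (mem_filter.1 hx).1] at hzero
        exact (hpos x (by simp)).ne' (hzero x (mem_filter.2 ⟨hx, htail⟩))
    have hr' : ∀ j, ∀ x ∈ X j, x.1.2 = t → r ≤ x.2.2 := by
      intro j x hx hxt
      by_contra hlt
      have hxA := (hX' j).mem x hx
      have hzero := hsink x.2.2 (by omega)
      rw [sum_in_eq f t (mem_timedArcs.1 hxA).2.2, Finset.sum_eq_zero_iff_of_nonneg
          fun x hx => hf0 x (mem_filter.1 hx).1] at hzero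
      exact ((hX j).2 x hx).ne' (hzero x (mem_filter.2 ⟨hxA, by simp [timedHead, hxt]⟩))
    have hocc : ∀ e ∈ E, ∀ k : Fin (K + 1), ∑ l ∈ Finset.Icc (k : ℕ) M, δ e k l
        = ∑ j, w j * occupation M (X j) e k := by
      intro e he k
      simp only [occupation, Finset.mul_sum]
      rw [Finset.sum_comm]
      refine Finset.sum_congr rfl fun l hl => ?_
      exact hdec (e, k, l) (mem_timedArcs.2 ⟨he, Finset.mem_Icc.1 hl⟩)
    have hwa : ∑ j, w j = a := by
      rw [haτ]
      have : ∀ l ∈ Finset.Icc r M, τ l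
          = ∑ j, w j * ((X j).countP (fun x => timedHead x = (t, l)) : ℝ) := by
        intro l hl
        rw [hτ l hl, sum_in_eq f t (Finset.mem_Icc.1 hl).2,
          ← sum_filter_sum_mul_count fun j _ => (hX' j).mem]
        exact Finset.sum_congr rfl fun x hx => hdec x (mem_filter.1 hx).1
      rw [Finset.sum_congr rfl this, Finset.sum_comm]
      refine Finset.sum_congr rfl fun j _ => ?_
      rw [← Finset.mul_sum, (hX' j).sum_countP_head hst (hr' j), mul_one]
    have hwg : ∀ e ∈ E, ∑ k, g e k
        = ∑ j, if e ∈ (X j).map Prod.fst then 0 else w j := by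
      intro e he
      have h1 := hga e he
      simp only [hocc e he] at h1
      rw [Finset.sum_comm] at h1
      simp only [← Finset.mul_sum, (hX' _).sum_occupation hord] at h1
      rw [eq_sub_of_add_eq h1, ← hwa, ← Finset.sum_sub_distrib]
      refine Finset.sum_congr rfl fun j _ => ?_
      split_ifs <;> ring
    obtain ⟨θ, hθ0, hθ1, hθp, hθr⟩ := exists_joint_of_paths hord hst hw hX' hr' hb hh hg hbh hwg
      (by rw [hwa]; linarith)
    refine ⟨_, ⟨θ, hθ0, hθ1, fun e he k => ?_, rfl⟩, hwa ▸ hθr⟩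
    rw [hθp e he k, ← hocc e he k, hp e he k]
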